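/- arXiv:2509.00929 — 2 statements merged into one kernel-verified Lean document; each statement's English description precedes it below -/
import Mathlib

section
/- For every i ∈ {1,...,5} (indices modulo 5), if A_i ≠ ∅ then B_{i−2} is anticomplete to B_{i+2}. -/
open SimpleGraph

/-- The disjoint union `P2 ∪ P3`: an edge 0-1 together with a path 2-3-4. -/
def p2p3 : SimpleGraph (Fin 5) :=
  SimpleGraph.fromEdgeSet {s(0,1), s(2,3), s(3,4)}

variable {V : Type*}

/-- `S0` is the vertex set of the induced 5-cycle. -/
def S0 (v : Fin 5 → V) : Set V := Set.range v

/-- `Aset H v i` is the set of vertices outside `S0` whose neighborhood in `S0`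
is exactly `{v i}`. -/
def Aset (H : SimpleGraph V) (v : Fin 5 → V) (i : Fin 5) : Set V :=
  {x | x ∉ S0 v ∧ ∀ j : Fin 5, H.Adj x (v j) ↔ j = i}

/-- `Bset H v i` is the set of vertices outside `S0` whose neighborhood in `S0`
is exactly `{v (i-1), v (i+1)}`. -/
def Bset (H : SimpleGraph V) (v : Fin 5 → V) (i : Fin 5) : Set V :=
  {x | x ∉ S0 v ∧ ∀ j : Fin 5, H.Adj x (v j) ↔ (j = i - 1 ∨ j = i + 1)}

/-- `S2set H v` is the set of vertices at distance exactly 2 from `S0`: vertices outside `S0`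
with no neighbor in `S0` but with a neighbor having a neighbor in `S0`. -/
def S2set (H : SimpleGraph V) (v : Fin 5 → V) : Set V :=
  {x | x ∉ S0 v ∧ (∀ j : Fin 5, ¬ H.Adj x (v j)) ∧
    ∃ y, H.Adj x y ∧ ∃ j : Fin 5, H.Adj y (v j)}

/-- `S` is complete to `T`: every vertex of `S` is adjacent to every vertex of `T`. -/
def Complete (H : SimpleGraph V) (S T : Set V) : Prop := ∀ x ∈ S, ∀ y ∈ T, H.Adj x y

/-- `S` is anticomplete to `T`: there are no edges between `S` and `T`. -/
def Anticomplete (H : SimpleGraph V) (S T : Set V) : Prop := ∀ x ∈ S, ∀ y ∈ T, ¬ H.Adj x y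

/-- `hA` is the number of indices `i` with `A_i` nonempty. -/
noncomputable def hA (H : SimpleGraph V) (v : Fin 5 → V) : ℕ :=
  {i : Fin 5 | (Aset H v i).Nonempty}.ncard

/-- `hB` is the number of indices `i` with `B_i` nonempty. -/
noncomputable def hB (H : SimpleGraph V) (v : Fin 5 → V) : ℕ :=
  {i : Fin 5 | (Bset H v i).Nonempty}.ncard

/-- An edge `a b` and an induced path `c d e` with no edges between them form an induced copy
of `p2p3`. -/
theorem nonempty_p2p3_embedding {V : Type*} (H : SimpleGraph V) {a b c d e : V}
    (hab : H.Adj a b) (hcd : H.Adj c d) (hde : H.Adj d e) (hne : c ≠ e) (hce : ¬ H.Adj c e)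
    (hac : ¬ H.Adj a c) (had : ¬ H.Adj a d) (hae : ¬ H.Adj a e)
    (hbc : ¬ H.Adj b c) (hbd : ¬ H.Adj b d) (hbe : ¬ H.Adj b e) :
    Nonempty (p2p3 ↪g H) := by
  have hab' := hab.symm
  have hcd' := hcd.symm
  have hde' := hde.symm
  have nac : a ≠ c := by rintro rfl; exact hbc hab'
  have nad : a ≠ d := by rintro rfl; exact hbd hab'
  have nae : a ≠ e := by rintro rfl; exact hbe hab'
  have nbc : b ≠ c := by rintro rfl; exact hac hab
  have nbd : b ≠ d := by rintro rfl; exact had hab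
  have nbe : b ≠ e := by rintro rfl; exact hae hab
  refine ⟨⟨⟨![a, b, c, d, e], ?_⟩, ?_⟩⟩
  · intro m n h
    fin_cases m <;> fin_cases n <;> first
      | rfl
      | simp [hab.ne, hab.ne', hcd.ne, hcd.ne', hde.ne, hde.ne', hne, hne.symm, nac, nac.symm,
          nad, nad.symm, nae, nae.symm, nbc, nbc.symm, nbd, nbd.symm, nbe, nbe.symm] at h
  · intro m n
    change H.Adj (![a, b, c, d, e] m) (![a, b, c, d, e] n) ↔ p2p3.Adj m n
    fin_cases m <;> fin_cases n <;>
      simp [p2p3, hab, hcd, hde, hab', hcd', hde', hce, hac, had, hae, hbc, hbd, hbe,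
        H.adj_comm e c, H.adj_comm c a, H.adj_comm d a, H.adj_comm e a,
        H.adj_comm c b, H.adj_comm d b, H.adj_comm e b]

/-- In a `p2p3`-free graph, if `y` sees `w` but not `u` on an edge `u w`, then every neighbor `a`
of a vertex `b`, where `a` misses `u w` and `b` misses `u w` and `y`, is adjacent to `y`. -/
theorem adj_of_p2p3_free {V : Type*} (H : SimpleGraph V) (hP2P3 : ¬ Nonempty (p2p3 ↪g H))
    {a b u w y : V} (hab : H.Adj a b) (huw : H.Adj u w) (hyw : H.Adj y w) (hne : u ≠ y)
    (hyu : ¬ H.Adj y u) (hau : ¬ H.Adj a u) (haw : ¬ H.Adj a w)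
    (hbu : ¬ H.Adj b u) (hbw : ¬ H.Adj b w) (hyb : ¬ H.Adj y b) : H.Adj a y := by
  by_contra hay
  exact hP2P3 (nonempty_p2p3_embedding H hab huw hyw.symm hne (fun h => hyu h.symm)
    hau haw hay hbu hbw (fun h => hyb h.symm))

theorem stmt9 {V : Type*} [Fintype V] (H : SimpleGraph V) (v : Fin 5 → V)
    (hinj : Function.Injective v)
    (hC5 : ∀ i j : Fin 5, H.Adj (v i) (v j) ↔ (j = i + 1 ∨ i = j + 1))
    (htriangle : H.CliqueFree 3)
    (hP2P3 : ¬ Nonempty (p2p3 ↪g H))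
    : ∀ i : Fin 5, (Aset H v i).Nonempty →
      Anticomplete H (Bset H v (i - 2)) (Bset H v (i + 2)) := by
  rintro i ⟨a, -, ha⟩ x ⟨hxS, hx⟩ y ⟨hyS, hy⟩ hxy
  have hay : H.Adj a y := by
    refine adj_of_p2p3_free H hP2P3 (b := v i) (u := v (i + 2)) (w := v (i + 3))
      ?_ ?_ ?_ (fun h => hyS ⟨_, h⟩) ?_ ?_ ?_ ?_ ?_ ?_ <;>
    simp only [ha, hy, hC5] <;> clear * - <;> revert i <;> decide
  have hax : H.Adj a x := by
    refine adj_of_p2p3_free H hP2P3 (b := v i) (u := v (i + 3)) (w := v (i + 2))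
      ?_ ?_ ?_ (fun h => hxS ⟨_, h⟩) ?_ ?_ ?_ ?_ ?_ ?_ <;>
    simp only [ha, hx, hC5] <;> clear * - <;> revert i <;> decide
  classical
  exact htriangle {a, x, y} (is3Clique_triple_iff.2 ⟨hax, hay, hxy⟩)
end

section
/- If either (1) exactly two of the sets B_1,...,B_5 are nonempty, these are B_{i−1} and B_i for some i ∈ {1,...,5} (indices modulo 5), and B_{i−1} is anticomplete to B_i, or (2) B_{i−1}, B_i and B_{i+1} are all nonempty for some i ∈ {1,...,5} and either B_{i−1} is anticomplete to B_i or B_i is anticomplete to B_{i+1}, then |B_j| ≤ 1 for every j ∈ {1,...,5}, the union B_1 ∪ ... ∪ B_5 is an independent set, |S2| ≤ 1, and S2 is complete to B_1 ∪ ... ∪ B_5. -/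
open SimpleGraph

variable {V : Type*}

/-- An edge `a b` and a path `c d e` with no edges in between induce a copy of `P2 ∪ P3`. -/
theorem p2p3_embedding {H : SimpleGraph V} {a b c d e : V} (hab : H.Adj a b) (hcd : H.Adj c d)
    (hde : H.Adj d e) (hne : c ≠ e) (hce : ¬ H.Adj c e)
    (hac : ¬ H.Adj a c) (had : ¬ H.Adj a d) (hae : ¬ H.Adj a e)
    (hbc : ¬ H.Adj b c) (hbd : ¬ H.Adj b d) (hbe : ¬ H.Adj b e) :
    Nonempty (p2p3 ↪g H) := by
  have h1 : a ≠ c := by rintro rfl; exact hbc hab.symm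
  have h2 : a ≠ d := by rintro rfl; exact hac hcd.symm
  have h3 : a ≠ e := by rintro rfl; exact hbe hab.symm
  have h4 : b ≠ c := by rintro rfl; exact hac hab
  have h5 : b ≠ d := by rintro rfl; exact had hab
  have h6 : b ≠ e := by rintro rfl; exact hae hab
  have h7 := hab.ne
  have h8 := hcd.ne
  have h9 := hde.ne
  refine ⟨⟨⟨![a, b, c, d, e], ?_⟩, ?_⟩⟩
  · intro x y hxy
    fin_cases x <;> fin_cases y <;> simp_all
  · intro x y
    change H.Adj (![a, b, c, d, e] x) (![a, b, c, d, e] y) ↔ _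
    fin_cases x <;> fin_cases y <;> simp_all [p2p3, H.adj_comm]

theorem SimpleGraph.CliqueFree.not_adj_of_adj_of_adj {H : SimpleGraph V} (hT : H.CliqueFree 3)
    {a b c : V} (hab : H.Adj a b) (hac : H.Adj a c) : ¬ H.Adj b c := by
  classical
  exact fun hbc => hT {a, b, c} (is3Clique_triple_iff.2 ⟨hab, hac, hbc⟩)

section InducedC5

variable {H : SimpleGraph V} {v : Fin 5 → V}

theorem adj_of_mem_Bset {x : V} {i j : Fin 5} (hx : x ∈ Bset H v i) (h : j = i - 1 ∨ j = i + 1) :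
    H.Adj x (v j) :=
  (hx.2 j).2 h

theorem not_adj_of_mem_Bset {x : V} {i j : Fin 5} (hx : x ∈ Bset H v i)
    (h : ¬ (j = i - 1 ∨ j = i + 1)) : ¬ H.Adj x (v j) :=
  mt (hx.2 j).1 h

theorem not_adj_of_mem_Bset_of_not_consecutive (hT : H.CliqueFree 3) {x y : V} {i j : Fin 5}
    (hx : x ∈ Bset H v i) (hy : y ∈ Bset H v j) (hij : j ≠ i + 1) (hji : i ≠ j + 1) :
    ¬ H.Adj x y := by
  obtain ⟨k, hki, hkj⟩ : ∃ k : Fin 5, (k = i - 1 ∨ k = i + 1) ∧ (k = j - 1 ∨ k = j + 1) := by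
    clear hx hy
    revert i j
    decide
  exact hT.not_adj_of_adj_of_adj (adj_of_mem_Bset hx hki).symm (adj_of_mem_Bset hy hkj).symm

theorem mem_Bset_of_adj (hC5 : ∀ i j : Fin 5, H.Adj (v i) (v j) ↔ (j = i + 1 ∨ i = j + 1))
    (hT : H.CliqueFree 3) {y : V} {i : Fin 5} (hy : y ∉ S0 v)
    (h1 : H.Adj y (v (i - 1))) (h2 : H.Adj y (v (i + 1))) : y ∈ Bset H v i := by
  refine ⟨hy, fun j => ⟨fun hj => ?_, ?_⟩⟩
  · have h3 := mt (hC5 _ _).2 (hT.not_adj_of_adj_of_adj h1 hj)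
    have h4 := mt (hC5 _ _).2 (hT.not_adj_of_adj_of_adj h2 hj)
    clear * - h3 h4
    revert i j
    decide
  · rintro (rfl | rfl)
    exacts [h1, h2]

/-- Nonadjacent consecutive classes are propagated along three consecutive indices; the step `s`
encodes the direction around the cycle. -/
theorem not_adj_Bset_step (hC5 : ∀ i j : Fin 5, H.Adj (v i) (v j) ↔ (j = i + 1 ∨ i = j + 1))
    (hT : H.CliqueFree 3) (hP : ¬ Nonempty (p2p3 ↪g H)) {b c d : V} {i s : Fin 5}
    (hs : s = 1 ∨ s = -1) (hb : b ∈ Bset H v i) (hc : c ∈ Bset H v (i + s))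
    (hd : d ∈ Bset H v (i + 2 * s)) (hbc : ¬ H.Adj b c) : ¬ H.Adj c d := by
  intro hcd
  have hvd : ¬ H.Adj d (v (i + 2 * s)) :=
    not_adj_of_mem_Bset hd (by clear * - hs; revert hs; decide +revert)
  refine hP (p2p3_embedding (a := b) (b := v (i - s)) (c := d) (d := c) (e := v (i + 2 * s))
    (adj_of_mem_Bset hb (by clear * - hs; revert hs; decide +revert)) hcd.symm
    (adj_of_mem_Bset hc (by clear * - hs; revert hs; decide +revert)) ?_ hvd ?_ hbc ?_ ?_ ?_ ?_)
  · exact fun h => hd.1 ⟨_, h.symm⟩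
  · exact not_adj_of_mem_Bset_of_not_consecutive hT hb hd
      (by clear * - hs; revert hs; decide +revert) (by clear * - hs; revert hs; decide +revert)
  · exact not_adj_of_mem_Bset hb (by clear * - hs; revert hs; decide +revert)
  · rw [H.adj_comm]
    exact not_adj_of_mem_Bset hd (by clear * - hs; revert hs; decide +revert)
  · rw [H.adj_comm]
    exact not_adj_of_mem_Bset hc (by clear * - hs; revert hs; decide +revert)
  · exact mt (hC5 _ _).1 (by clear * - hs; revert hs; decide +revert)

theorem eq_of_mem_Bset_of_not_adj
    (hC5 : ∀ i j : Fin 5, H.Adj (v i) (v j) ↔ (j = i + 1 ∨ i = j + 1))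
    (hT : H.CliqueFree 3) (hP : ¬ Nonempty (p2p3 ↪g H)) {b b' c : V} {i s : Fin 5}
    (hs : s = 1 ∨ s = -1) (hb : b ∈ Bset H v i) (hb' : b' ∈ Bset H v i)
    (hc : c ∈ Bset H v (i + s)) (hcb : ¬ H.Adj c b) (hcb' : ¬ H.Adj c b') : b = b' := by
  by_contra hne
  have hv : i - s = i - 1 ∨ i - s = i + 1 := by clear * - hs; revert hs; decide +revert
  have hw : ¬ (i + 2 * s = i - 1 ∨ i + 2 * s = i + 1) := by clear * - hs; revert hs; decide +revert
  have h1 := adj_of_mem_Bset hb hv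
  have h2 := adj_of_mem_Bset hb' hv
  refine hP (p2p3_embedding (a := c) (b := v (i + 2 * s)) (c := b) (d := v (i - s)) (e := b')
    (adj_of_mem_Bset hc (by clear * - hs; revert hs; decide +revert)) h1 h2.symm hne
    (hT.not_adj_of_adj_of_adj h1.symm h2.symm) hcb ?_ hcb' ?_ ?_ ?_)
  · exact not_adj_of_mem_Bset hc (by clear * - hs; revert hs; decide +revert)
  · exact fun h => not_adj_of_mem_Bset hb hw h.symm
  · exact mt (hC5 _ _).1 (by clear * - hs; revert hs; decide +revert)
  · exact fun h => not_adj_of_mem_Bset hb' hw h.symm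

theorem adj_Bset_step_of_mem_S2set
    (hC5 : ∀ i j : Fin 5, H.Adj (v i) (v j) ↔ (j = i + 1 ∨ i = j + 1))
    (hinj : Function.Injective v) (hP : ¬ Nonempty (p2p3 ↪g H)) {t b c : V} {i s : Fin 5}
    (hs : s = 1 ∨ s = -1) (ht : t ∈ S2set H v) (hb : b ∈ Bset H v i)
    (hc : c ∈ Bset H v (i + s)) (hbc : ¬ H.Adj b c) (htb : H.Adj t b) : H.Adj t c := by
  by_contra htc
  refine hP (p2p3_embedding (a := t) (b := b) (c := v i) (d := c) (e := v (i + 2 * s))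
    htb (adj_of_mem_Bset hc (by clear * - hs; revert hs; decide +revert)).symm
    (adj_of_mem_Bset hc (by clear * - hs; revert hs; decide +revert)) ?_ ?_ (ht.2.1 _) htc (ht.2.1 _)
    ?_ hbc ?_)
  · exact hinj.ne (by clear * - hs; revert hs; decide +revert)
  · exact mt (hC5 _ _).1 (by clear * - hs; revert hs; decide +revert)
  · exact not_adj_of_mem_Bset hb (by clear * - hs; revert hs; decide +revert)
  · exact not_adj_of_mem_Bset hb (by clear * - hs; revert hs; decide +revert)

theorem exists_adj_Bset_of_mem_S2set
    (hC5 : ∀ i j : Fin 5, H.Adj (v i) (v j) ↔ (j = i + 1 ∨ i = j + 1))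
    (hinj : Function.Injective v) (hT : H.CliqueFree 3) (hP : ¬ Nonempty (p2p3 ↪g H)) {t : V}
    (ht : t ∈ S2set H v) : ∃ i, ∃ b ∈ Bset H v i, H.Adj t b := by
  obtain ⟨-, hnt, y, hty, j, hyj⟩ := ht
  have hy : y ∉ S0 v := by
    rintro ⟨k, rfl⟩
    exact hnt k hty
  have hy1 : ¬ H.Adj y (v (j + 1)) := fun h =>
    hT.not_adj_of_adj_of_adj hyj h ((hC5 _ _).2 (Or.inl rfl))
  by_cases h2 : H.Adj y (v (j + 2))
  · refine ⟨j + 1, y, mem_Bset_of_adj hC5 hT hy ?_ ?_, hty⟩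
    · rwa [add_sub_cancel_right]
    · rwa [add_assoc]
  by_cases h3 : H.Adj y (v (j + 3))
  · refine ⟨j + 4, y, mem_Bset_of_adj hC5 hT hy ?_ ?_, hty⟩
    · rwa [show j + 4 - 1 = j + 3 from by clear * -; decide +revert]
    · rwa [show j + 4 + 1 = j from by clear * -; decide +revert]
  exact (hP (p2p3_embedding (a := t) (b := y) (c := v (j + 1)) (d := v (j + 2))
    (e := v (j + 3)) hty ((hC5 _ _).2 (by clear * -; decide +revert))
    ((hC5 _ _).2 (by clear * -; decide +revert)) (hinj.ne (by clear * -; decide +revert))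
    (mt (hC5 _ _).1 (by clear * -; decide +revert)) (hnt _) (hnt _) (hnt _) hy1 h2 h3)).elim

theorem eq_of_mem_S2set_of_adj_Bset
    (hC5 : ∀ i j : Fin 5, H.Adj (v i) (v j) ↔ (j = i + 1 ∨ i = j + 1))
    (hT : H.CliqueFree 3) (hP : ¬ Nonempty (p2p3 ↪g H)) {t t' b : V} {i : Fin 5}
    (ht : t ∈ S2set H v) (ht' : t' ∈ S2set H v) (hb : b ∈ Bset H v i)
    (htb : H.Adj t b) (htb' : H.Adj t' b) : t = t' := by
  by_contra hne
  have h1 := ht.2.1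
  have h2 := ht'.2.1
  refine hP (p2p3_embedding (a := v (i + 2)) (b := v (i + 3)) (c := t) (d := b) (e := t')
    ((hC5 _ _).2 (by clear * -; decide +revert)) htb htb'.symm hne
    (hT.not_adj_of_adj_of_adj htb.symm htb'.symm)
    (fun h => h1 _ h.symm) ?_ (fun h => h2 _ h.symm)
    (fun h => h1 _ h.symm) ?_ (fun h => h2 _ h.symm))
  · exact fun h => not_adj_of_mem_Bset hb (by clear * -; decide +revert) h.symm
  · exact fun h => not_adj_of_mem_Bset hb (by clear * -; decide +revert) h.symm

/-- The conclusion when `B_i`, `B_{i+1}` are nonempty and anticomplete to each other, and the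
indices of the nonempty classes are contiguous around the cycle. -/
theorem Bset_and_S2set_of_anticomplete [Finite V]
    (hC5 : ∀ i j : Fin 5, H.Adj (v i) (v j) ↔ (j = i + 1 ∨ i = j + 1))
    (hinj : Function.Injective v) (hT : H.CliqueFree 3) (hP : ¬ Nonempty (p2p3 ↪g H))
    {i : Fin 5} (hi : (Bset H v i).Nonempty) (hi1 : (Bset H v (i + 1)).Nonempty)
    (hanti : Anticomplete H (Bset H v i) (Bset H v (i + 1)))
    (hcontig : (Bset H v (i + 3)).Nonempty →
      (Bset H v (i + 2)).Nonempty ∨ (Bset H v (i + 4)).Nonempty) :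
    (∀ j : Fin 5, (Bset H v j).ncard ≤ 1) ∧
      (∀ x ∈ ⋃ j : Fin 5, Bset H v j, ∀ y ∈ ⋃ j : Fin 5, Bset H v j, ¬ H.Adj x y) ∧
      (S2set H v).ncard ≤ 1 ∧
      Complete H (S2set H v) (⋃ j : Fin 5, Bset H v j) := by
  have cover : ∀ {p : Fin 5 → Prop}, p i → p (i + 1) → p (i + 2) → p (i + 3) → p (i + 4) →
      ∀ j, p j := by
    intro p h0 h1 h2 h3 h4 j
    have : j = i ∨ j = i + 1 ∨ j = i + 2 ∨ j = i + 3 ∨ j = i + 4 := by clear * -; decide +revert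
    rcases this with rfl | rfl | rfl | rfl | rfl <;> assumption
  have e2 : i + 1 + 1 = i + 2 := by clear * -; decide +revert
  have e3 : i + 2 + 1 = i + 3 := by clear * -; decide +revert
  have e4 : i + 3 + 1 = i + 4 := by clear * -; decide +revert
  have e5 : i + 4 + 1 = i := by clear * -; decide +revert
  have forward : ∀ j, (Bset H v j).Nonempty → Anticomplete H (Bset H v j) (Bset H v (j + 1)) →
      Anticomplete H (Bset H v (j + 1)) (Bset H v (j + 1 + 1)) := by
    rintro j ⟨b, hb⟩ h c hc d hd
    rw [show j + 1 + 1 = j + 2 * 1 from by clear * -; decide +revert] at hd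
    exact not_adj_Bset_step hC5 hT hP (Or.inl rfl) hb hc hd (h b hb c hc)
  have backward : ∀ j, (Bset H v (j + 1 + 1)).Nonempty →
      Anticomplete H (Bset H v (j + 1)) (Bset H v (j + 1 + 1)) →
      Anticomplete H (Bset H v j) (Bset H v (j + 1)) := by
    rintro j ⟨b, hb⟩ h d hd c hc hdc
    refine not_adj_Bset_step hC5 hT hP (i := j + 1 + 1) (s := -1) (Or.inr rfl) hb (c := c)
      (d := d) ?_ ?_ (fun hbc => h c hc b hb hbc.symm) hdc.symm
    · rwa [show j + 1 + 1 + -1 = j + 1 from by clear * -; decide +revert]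
    · rwa [show j + 1 + 1 + 2 * -1 = j from by clear * -; decide +revert]
  have hcons : ∀ j, Anticomplete H (Bset H v j) (Bset H v (j + 1)) := by
    have h1 := forward i hi hanti
    have h4 : Anticomplete H (Bset H v (i + 4)) (Bset H v (i + 4 + 1)) :=
      backward (i + 4) (by rwa [e5]) (by rwa [e5])
    refine cover hanti h1 ?_ ?_ h4
    · intro x hx
      rw [← e2] at hx ⊢
      exact forward (i + 1) hi1 h1 x hx
    · intro x hx y hy
      refine backward (i + 3) ?_ ?_ x hx y hy
      · rwa [e4, e5]
      · rwa [e4]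
  have hnbr : ∀ j, (Bset H v j).Nonempty →
      (Bset H v (j + 1)).Nonempty ∨ (Bset H v (j + -1)).Nonempty := by
    have f1 : i + 1 + -1 = i := by clear * -; decide +revert
    have f2 : i + 2 + -1 = i + 1 := by clear * -; decide +revert
    have f3 : i + 3 + -1 = i + 2 := by clear * -; decide +revert
    refine cover (fun _ => Or.inl hi1) (fun _ => Or.inr ?_) (fun _ => Or.inr ?_) (fun h => ?_)
      (fun _ => Or.inl ?_)
    · rwa [f1]
    · rwa [f2]
    · rw [e4, f3]
      exact (hcontig h).symm
    · rwa [e5]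
  have hind : ∀ j k, ∀ x ∈ Bset H v j, ∀ y ∈ Bset H v k, ¬ H.Adj x y := by
    intro j k x hx y hy
    by_cases hjk : k = j + 1
    · subst hjk
      exact hcons j x hx y hy
    by_cases hkj : j = k + 1
    · subst hkj
      exact fun h => hcons k y hy x hx h.symm
    exact not_adj_of_mem_Bset_of_not_consecutive hT hx hy hjk hkj
  have heq : ∀ j, ∀ x ∈ Bset H v j, ∀ y ∈ Bset H v j, x = y := by
    intro j x hx y hy
    rcases hnbr j ⟨x, hx⟩ with ⟨c, hc⟩ | ⟨c, hc⟩
    · exact eq_of_mem_Bset_of_not_adj hC5 hT hP (Or.inl rfl) hx hy hc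
        (hind _ _ c hc x hx) (hind _ _ c hc y hy)
    · exact eq_of_mem_Bset_of_not_adj hC5 hT hP (Or.inr rfl) hx hy hc
        (hind _ _ c hc x hx) (hind _ _ c hc y hy)
  have hcomplete : ∀ t ∈ S2set H v, ∀ j, ∀ c ∈ Bset H v j, H.Adj t c := by
    intro t ht
    have up : ∀ j, (Bset H v j).Nonempty → (∀ c ∈ Bset H v j, H.Adj t c) →
        ∀ c ∈ Bset H v (j + 1), H.Adj t c := by
      rintro j ⟨b, hb⟩ h c hc
      exact adj_Bset_step_of_mem_S2set hC5 hinj hP (Or.inl rfl) ht hb hc (hind _ _ b hb c hc)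
        (h b hb)
    have down : ∀ j, (Bset H v (j + 1)).Nonempty → (∀ c ∈ Bset H v (j + 1), H.Adj t c) →
        ∀ c ∈ Bset H v j, H.Adj t c := by
      rintro j ⟨b, hb⟩ h c hc
      refine adj_Bset_step_of_mem_S2set hC5 hinj hP (i := j + 1) (s := -1) (Or.inr rfl) ht hb
        ?_ (hind _ _ b hb c hc) (h b hb)
      rwa [add_neg_cancel_right]
    obtain ⟨k, b, hb, htb⟩ := exists_adj_Bset_of_mem_S2set hC5 hinj hT hP ht
    have hk : ∀ c ∈ Bset H v k, H.Adj t c := fun c hc => heq k b hb c hc ▸ htb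
    have hkne : (Bset H v k).Nonempty := ⟨b, hb⟩
    have u0 := up i hi
    have u1 := up (i + 1) hi1
    have u2 := up (i + 2)
    have u3 := up (i + 3)
    have u4 := up (i + 4)
    have d0 := down i hi1
    have d1 := down (i + 1)
    have d2 := down (i + 2)
    have d3 := down (i + 3)
    have d4 := down (i + 4)
    rw [e2] at u1 d1
    rw [e3] at u2 d2
    rw [e4] at u3 d3
    rw [e5] at u4 d4
    have hk0 : ∀ c ∈ Bset H v i, H.Adj t c := by
      revert hk hkne
      refine cover (p := fun k => (∀ c ∈ Bset H v k, H.Adj t c) → (Bset H v k).Nonempty →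
        ∀ c ∈ Bset H v i, H.Adj t c) ?_ ?_ ?_ ?_ ?_ k
      · exact fun h _ => h
      · exact fun h _ => d0 h
      · exact fun h hne => d0 (d1 hne h)
      · intro h hne
        rcases hcontig hne with h2 | h4
        · exact d0 (d1 h2 (d2 hne h))
        · exact u4 h4 (u3 hne h)
      · exact fun h hne => u4 hne h
    refine cover hk0 (u0 hk0) (u1 (u0 hk0)) (fun c hc => ?_) (d4 hi hk0)
    rcases hcontig ⟨c, hc⟩ with h2 | h4
    · exact u2 h2 (u1 (u0 hk0)) c hc
    · exact d3 h4 (d4 hi hk0) c hc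
  refine ⟨fun j => ?_, ?_, ?_, ?_⟩
  · exact (Set.ncard_le_one (Set.toFinite _)).2 (heq j)
  · intro x hx y hy
    obtain ⟨j, hj⟩ := Set.mem_iUnion.1 hx
    obtain ⟨k, hk⟩ := Set.mem_iUnion.1 hy
    exact hind j k x hj y hk
  · obtain ⟨b, hb⟩ := hi
    exact (Set.ncard_le_one (Set.toFinite _)).2 fun t ht t' ht' =>
      eq_of_mem_S2set_of_adj_Bset hC5 hT hP ht ht' hb (hcomplete t ht i b hb)
        (hcomplete t' ht' i b hb)
  · intro t ht x hx
    obtain ⟨j, hj⟩ := Set.mem_iUnion.1 hx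
    exact hcomplete t ht j x hj

end InducedC5


theorem stmt16 {V : Type*} [Fintype V] (H : SimpleGraph V) (v : Fin 5 → V)
    (hinj : Function.Injective v)
    (hC5 : ∀ i j : Fin 5, H.Adj (v i) (v j) ↔ (j = i + 1 ∨ i = j + 1))
    (htriangle : H.CliqueFree 3)
    (hP2P3 : ¬ Nonempty (p2p3 ↪g H))
    (hcase : (∃ i : Fin 5, hB H v = 2 ∧ (Bset H v (i - 1)).Nonempty ∧ (Bset H v i).Nonempty ∧
        Anticomplete H (Bset H v (i - 1)) (Bset H v i)) ∨
      (∃ i : Fin 5, (Bset H v (i - 1)).Nonempty ∧ (Bset H v i).Nonempty ∧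
        (Bset H v (i + 1)).Nonempty ∧
        (Anticomplete H (Bset H v (i - 1)) (Bset H v i) ∨
          Anticomplete H (Bset H v i) (Bset H v (i + 1)))))
    : (∀ j : Fin 5, (Bset H v j).ncard ≤ 1) ∧
      (∀ x ∈ ⋃ j : Fin 5, Bset H v j, ∀ y ∈ ⋃ j : Fin 5, Bset H v j, ¬ H.Adj x y) ∧
      (S2set H v).ncard ≤ 1 ∧
      Complete H (S2set H v) (⋃ j : Fin 5, Bset H v j) := by
  rcases hcase with ⟨i, hcard, h0, h1, hanti⟩ | ⟨i, h0, h1, h2, hanti | hanti⟩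
  · refine Bset_and_S2set_of_anticomplete hC5 hinj htriangle hP2P3 (i := i - 1) h0
      (by rwa [sub_add_cancel]) (by rwa [sub_add_cancel]) fun h3 => ?_
    have hsub : (({i - 1, i, i - 1 + 3} : Finset (Fin 5)) : Set (Fin 5)) ⊆
        {j | (Bset H v j).Nonempty} := by
      intro j hj
      simp only [Finset.coe_insert, Finset.coe_singleton, Set.mem_insert_iff,
        Set.mem_singleton_iff] at hj
      rcases hj with rfl | rfl | rfl <;> assumption
    have hle := Set.ncard_le_ncard hsub (Set.toFinite _)
    rw [Set.ncard_coe_finset,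
      show ({i - 1, i, i - 1 + 3} : Finset (Fin 5)).card = 3 from by
        clear * -; decide +revert] at hle
    rw [hB] at hcard
    omega
  · refine Bset_and_S2set_of_anticomplete hC5 hinj htriangle hP2P3 (i := i - 1) h0
      (by rwa [sub_add_cancel]) (by rwa [sub_add_cancel]) fun _ => Or.inl ?_
    rwa [show i - 1 + 2 = i + 1 from by clear * -; decide +revert]
  · refine Bset_and_S2set_of_anticomplete hC5 hinj htriangle hP2P3 h1 h2 hanti fun _ =>
      Or.inr ?_
    rwa [show i + 4 = i - 1 from by clear * -; decide +revert]
end
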